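/- W.h.p. Q^n(1.5) consists of at most 5·2^n / (n·log₂log₂ n) connected components. -/

import Mathlib

open scoped Classical
open Filter

noncomputable section

/-- The vertex set of the `n`-dimensional hypercube: `{0,1}^n`. -/
abbrev Vtx (n : ℕ) := Fin n → Bool

/-- The `n`-dimensional hypercube graph `Q^n`: two vertices are adjacent iff they
differ in exactly one coordinate. -/
def cubeGraph (n : ℕ) : SimpleGraph (Vtx n) :=
  SimpleGraph.fromRel (fun u v => hammingDist u v = 1)

/-- `v` belongs to `V₀`, i.e. the sum of the coordinates of `v` is even. -/
def evenVtx {n : ℕ} (v : Vtx n) : Prop :=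
  Even (Finset.univ.filter (fun i : Fin n => v i = true)).card

/-- Sample space for `Q^n(1.5)`: every vertex `v` chooses a uniformly random
neighbour `e₁(v)` (first component), and every vertex of even coordinate sum
additionally chooses a uniformly random neighbour `e_{1.5}(v)` distinct from
`e₁(v)` (second component; for odd vertices the second choice is a dummy).
The uniform measure on this set is exactly the law of `(e₁, e_{1.5})`. -/
abbrev Space15 (n : ℕ) :=
  {p : (∀ v : Vtx n, {u : Vtx n // (cubeGraph n).Adj v u}) ×
       (∀ v : Vtx n, {u : Vtx n // (cubeGraph n).Adj v u}) //
    ∀ v : Vtx n, evenVtx v → (p.2 v : Vtx n) ≠ (p.1 v : Vtx n)}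

/-- The random graph `Q^n(1.5)`: its edges are `{v, e₁(v)}` for every vertex `v`,
together with `{v, e_{1.5}(v)}` for every `v ∈ V₀`. -/
def graph15 (n : ℕ) (ω : Space15 n) : SimpleGraph (Vtx n) :=
  SimpleGraph.fromRel (fun u v =>
    (ω.1.1 u : Vtx n) = v ∨ (evenVtx u ∧ (ω.1.2 u : Vtx n) = v))

/-- Uniform (counting) probability of an event on a finite sample space. -/
def prob {Ω : Type*} [Finite Ω] (p : Ω → Prop) : ℝ :=
  (Nat.card {ω : Ω // p ω} : ℝ) / (Nat.card Ω : ℝ)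

/-- Number of vertices in the connected component of `v` in `G`. -/
def compSize {V : Type*} (G : SimpleGraph V) (v : V) : ℕ :=
  Nat.card {w : V // G.Reachable v w}

/-- The vertex obtained from `v` by flipping coordinate `i`. -/
def flipAt {n : ℕ} (v : Vtx n) (i : Fin n) : Vtx n := Function.update v i (!v i)

lemma flipAt_apply_self {n : ℕ} (v : Vtx n) (i : Fin n) : flipAt v i i = !v i := by
  simp [flipAt]

lemma flipAt_apply_of_ne {n : ℕ} (v : Vtx n) {i j : Fin n} (h : j ≠ i) : flipAt v i j = v j := by
  simp [flipAt, h]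

lemma flipAt_injective {n : ℕ} (v : Vtx n) : Function.Injective (flipAt v) := by
  intro i j h
  by_contra hij
  have := congrFun h i
  rw [flipAt_apply_self, flipAt_apply_of_ne v hij] at this
  simp at this

lemma flipAt_flipAt {n : ℕ} (v : Vtx n) (i : Fin n) : flipAt (flipAt v i) i = v := by
  simp [flipAt]

lemma hammingDist_flipAt {n : ℕ} (v : Vtx n) (i : Fin n) : hammingDist v (flipAt v i) = 1 := by
  rw [hammingDist, Finset.card_eq_one]
  refine ⟨i, ?_⟩
  ext j
  by_cases h : j = i
  · subst h; simp [flipAt_apply_self]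
  · simp [flipAt_apply_of_ne v h, h]

lemma cubeGraph_adj_iff {n : ℕ} {u v : Vtx n} :
    (cubeGraph n).Adj u v ↔ ∃ i, flipAt u i = v := by
  rw [cubeGraph, SimpleGraph.fromRel_adj, hammingDist_comm v u, or_self]
  constructor
  · rintro ⟨-, h⟩
    rw [hammingDist, Finset.card_eq_one] at h
    obtain ⟨i, hi⟩ := h
    refine ⟨i, funext fun j => ?_⟩
    have hj : u j ≠ v j ↔ j = i := by simpa using Finset.ext_iff.1 hi j
    by_cases h : j = i
    · subst h
      rw [flipAt_apply_self]
      have := hj.2 rfl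
      cases hu : u j <;> cases hv : v j <;> simp_all
    · rw [flipAt_apply_of_ne u h]
      by_contra h'
      exact h (hj.1 h')
  · rintro ⟨i, rfl⟩
    refine ⟨fun h => ?_, hammingDist_flipAt u i⟩
    have := hammingDist_flipAt u i
    rw [← h, hammingDist_self] at this
    exact zero_ne_one this

lemma evenVtx_of_adj {n : ℕ} {u v : Vtx n} (h : (cubeGraph n).Adj u v) (hu : ¬ evenVtx u) :
    evenVtx v := by
  obtain ⟨i, rfl⟩ := cubeGraph_adj_iff.1 h
  unfold evenVtx at *
  cases hi : u i
  · have : Finset.univ.filter (fun j => flipAt u i j = true)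
        = insert i (Finset.univ.filter (fun j => u j = true)) := by
      ext j
      by_cases hj : j = i
      · subst hj; simp [flipAt_apply_self, hi]
      · simp [flipAt_apply_of_ne u hj, hj]
    rw [this, Finset.card_insert_of_notMem (by simp [hi])]
    exact Nat.even_add_one.2 hu
  · have : insert i (Finset.univ.filter (fun j => flipAt u i j = true))
        = Finset.univ.filter (fun j => u j = true) := by
      ext j
      by_cases hj : j = i
      · subst hj; simp [hi]
      · simp [flipAt_apply_of_ne u hj, hj]
    rw [← this, Finset.card_insert_of_notMem (by simp [flipAt_apply_self, hi])] at hu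
    exact not_not.1 fun h => hu (Nat.even_add_one.2 h)

/-- The number of neighbours of `v` in the hypercube that lie in `S`. -/
def degIn {n : ℕ} (S : Finset (Vtx n)) (v : Vtx n) : ℕ :=
  (Finset.univ.filter fun i : Fin n => flipAt v i ∈ S).card

lemma degIn_le {n : ℕ} (S : Finset (Vtx n)) (v : Vtx n) : degIn S v ≤ n :=
  (Finset.card_le_univ _).trans (by simp)

lemma degIn_univ {n : ℕ} (v : Vtx n) : degIn Finset.univ v = n := by simp [degIn]

lemma card_filter_neighbor {n : ℕ} (S : Finset (Vtx n)) (v : Vtx n) :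
    (Finset.univ.filter fun u : {u : Vtx n // (cubeGraph n).Adj v u} => (u : Vtx n) ∈ S).card
      = degIn S v := by
  symm
  refine Finset.card_bij (fun i _ => ⟨flipAt v i, cubeGraph_adj_iff.2 ⟨i, rfl⟩⟩) ?_ ?_ ?_
  · intro i hi; simpa using hi
  · intro i _ j _ h; exact flipAt_injective v (congrArg Subtype.val h)
  · rintro ⟨u, hu⟩ h
    obtain ⟨i, rfl⟩ := cubeGraph_adj_iff.1 hu
    exact ⟨i, by simpa using h, rfl⟩

lemma mul_logb_add_mul_logb_add_two_mul_le {x y : ℝ} (hy : 0 ≤ y) (hyx : y ≤ x) :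
    x * Real.logb 2 x + y * Real.logb 2 y + 2 * y ≤ (x + y) * Real.logb 2 (x + y) := by
  rcases hy.eq_or_lt with rfl | hy
  · simp
  have hx : 0 < x := hy.trans_le hyx
  have h1 : y ≤ x * (Real.logb 2 (x + y) - Real.logb 2 x) := by
    rw [← Real.logb_div (by positivity) hx.ne']
    have ht : y / x ≤ Real.logb 2 ((x + y) / x) := by
      rw [Real.le_logb_iff_rpow_le (by norm_num) (by positivity)]
      have := rpow_one_add_le_one_add_mul_self (s := 1) (by norm_num) (p := y / x)
        (by positivity) ((div_le_one hx).2 hyx)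
      rw [add_div, div_self hx.ne']
      norm_num at this ⊢
      linarith
    calc y = x * (y / x) := by field_simp
      _ ≤ _ := by gcongr
  have h2 : y ≤ y * (Real.logb 2 (x + y) - Real.logb 2 y) := by
    rw [← Real.logb_div (by positivity) hy.ne']
    have : (1 : ℝ) ≤ Real.logb 2 ((x + y) / y) := by
      rw [Real.le_logb_iff_rpow_le (by norm_num) (by positivity), Real.rpow_one,
        le_div_iff₀ hy]
      linarith
    nlinarith
  linarith

/-- Edge isoperimetry in the hypercube, for the edges in the directions of `I`. -/
lemma sum_card_filter_flipAt_le {n : ℕ} (I : Finset (Fin n)) (S : Finset (Vtx n)) :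
    (∑ v ∈ S, ((I.filter fun i => flipAt v i ∈ S).card : ℝ)) ≤ S.card * Real.logb 2 S.card := by
  induction I using Finset.induction_on generalizing S with
  | empty =>
    rcases S.eq_empty_or_nonempty with rfl | hS
    · simp
    · have : (1 : ℝ) ≤ S.card := by exact_mod_cast hS.card_pos
      simpa using mul_nonneg (by positivity) (Real.logb_nonneg (by norm_num) this)
  | insert j I hj ih =>
    have key (b : Bool) :
        (∑ v ∈ S.filter (fun v => v j = b),
            (((insert j I).filter fun i => flipAt v i ∈ S).card : ℝ))
          = (∑ v ∈ S.filter (fun v => v j = b),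
            ((I.filter fun i => flipAt v i ∈ S.filter (fun v => v j = b)).card : ℝ))
            + ((S.filter (fun v => v j = b)).filter fun v => flipAt v j ∈ S).card := by
      rw [Finset.card_filter _ (S.filter _), Nat.cast_sum, ← Finset.sum_add_distrib]
      refine Finset.sum_congr rfl fun v hv => ?_
      have hvj : v j = b := (Finset.mem_filter.1 hv).2
      have : (I.filter fun i => flipAt v i ∈ S.filter (fun v => v j = b))
          = I.filter fun i => flipAt v i ∈ S := by
        refine Finset.filter_congr fun i hi => ?_
        have : j ≠ i := fun h => hj (h ▸ hi)
        simp [flipAt_apply_of_ne v this, hvj]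
      rw [this, Finset.filter_insert]
      split_ifs with h
      · rw [Finset.card_insert_of_notMem (by simp [hj])]; simp
      · simp
    have cross (b : Bool) :
        ((S.filter (fun v => v j = b)).filter fun v => flipAt v j ∈ S).card
          ≤ (S.filter (fun v => v j = !b)).card := by
      refine Finset.card_le_card_of_injOn (fun v => flipAt v j) ?_ ?_
      · intro v hv
        simp only [Finset.coe_filter, Finset.mem_filter, Set.mem_ofPred_eq] at hv ⊢
        exact ⟨hv.2, by rw [flipAt_apply_self, hv.1.2]⟩
      · intro v _ w _ h
        simpa [flipAt_flipAt] using congrArg (fun x => flipAt x j) h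
    have split (f : Vtx n → ℝ) : ∑ v ∈ S, f v
        = ∑ v ∈ S.filter (fun v => v j = true), f v
          + ∑ v ∈ S.filter (fun v => v j = false), f v := by
      rw [← Finset.sum_filter_add_sum_filter_not S (fun v => v j = true)]
      simp
    have hcard : (S.card : ℝ) = (S.filter (fun v => v j = true)).card
        + (S.filter (fun v => v j = false)).card := by
      simpa using split 1
    rw [split, key, key, hcard]
    have i1 := ih (S.filter (fun v => v j = true))
    have i2 := ih (S.filter (fun v => v j = false))
    have c1 : (((S.filter (fun v => v j = true)).filter fun v => flipAt v j ∈ S).card : ℝ)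
        ≤ (S.filter (fun v => v j = true)).card := by
      exact_mod_cast Finset.card_filter_le _ _
    have c2 : (((S.filter (fun v => v j = false)).filter fun v => flipAt v j ∈ S).card : ℝ)
        ≤ (S.filter (fun v => v j = false)).card := by
      exact_mod_cast Finset.card_filter_le _ _
    have c3 : (((S.filter (fun v => v j = true)).filter fun v => flipAt v j ∈ S).card : ℝ)
        ≤ (S.filter (fun v => v j = false)).card := by exact_mod_cast cross true
    have c4 : (((S.filter (fun v => v j = false)).filter fun v => flipAt v j ∈ S).card : ℝ)
        ≤ (S.filter (fun v => v j = true)).card := by exact_mod_cast cross false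
    rcases le_total ((S.filter (fun v => v j = true)).card : ℝ)
      (S.filter (fun v => v j = false)).card with h | h
    · have := mul_logb_add_mul_logb_add_two_mul_le (Nat.cast_nonneg _) h
      rw [add_comm ((S.filter (fun v => v j = true)).card : ℝ)]
      linarith
    · have := mul_logb_add_mul_logb_add_two_mul_le (Nat.cast_nonneg _) h
      linarith

lemma sum_degIn_le {n : ℕ} (S : Finset (Vtx n)) :
    (∑ v ∈ S, (degIn S v : ℝ)) ≤ S.card * Real.logb 2 S.card :=
  sum_card_filter_flipAt_le Finset.univ S

lemma prod_le_pow_card_of_sum_le {ι : Type*} (s : Finset ι) (d : ι → ℝ) {L : ℝ} (hL : 0 < L)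
    (hd : ∀ i ∈ s, 0 ≤ d i) (h : ∑ i ∈ s, d i ≤ s.card * L) : ∏ i ∈ s, d i ≤ L ^ s.card := by
  calc ∏ i ∈ s, d i ≤ ∏ i ∈ s, L * Real.exp (d i / L - 1) := by
        refine Finset.prod_le_prod hd fun i _ => ?_
        have := Real.add_one_le_exp (d i / L - 1)
        rw [sub_add_cancel, div_le_iff₀ hL] at this
        linarith
    _ = L ^ s.card * Real.exp ((∑ i ∈ s, d i) / L - s.card) := by
        rw [Finset.prod_mul_distrib, Finset.prod_const, ← Real.exp_sum, Finset.sum_sub_distrib,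
          Finset.sum_div]
        simp
    _ ≤ L ^ s.card * 1 := by
        gcongr
        rw [Real.exp_le_one_iff, sub_nonpos, div_le_iff₀ hL]
        exact h
    _ = L ^ s.card := mul_one _

/-- `S` cannot be split into two nonempty parts with no edge of the hypercube between them. -/
def CubeConnected {n : ℕ} (S : Finset (Vtx n)) : Prop :=
  ∀ T ⊂ S, T.Nonempty → ∃ u ∈ T, ∃ i, flipAt u i ∈ S \ T

/-- The outer vertex boundary of `S`. -/
def outerBoundary {n : ℕ} (S : Finset (Vtx n)) : Finset (Vtx n) :=
  (S.biUnion fun u => Finset.univ.image (flipAt u)) \ S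

lemma mem_outerBoundary {n : ℕ} {S : Finset (Vtx n)} {w : Vtx n} :
    w ∈ outerBoundary S ↔ (∃ u ∈ S, ∃ i, flipAt u i = w) ∧ w ∉ S := by
  simp [outerBoundary]

lemma card_outerBoundary_le {n : ℕ} (S : Finset (Vtx n)) :
    (outerBoundary S).card ≤ S.card * n := by
  refine (Finset.card_le_card Finset.sdiff_subset).trans ?_
  refine Finset.card_biUnion_le_card_mul _ _ _ fun u _ => ?_
  exact Finset.card_image_le.trans (by simp)

lemma CubeConnected.exists_mem_outerBoundary {n : ℕ} {S T : Finset (Vtx n)}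
    (hS : CubeConnected S) {v : Vtx n} (hvS : v ∈ S) (hvT : v ∈ T) (h : ¬ S ⊆ T) :
    ∃ w ∈ S, w ∈ outerBoundary T := by
  have hss : S ∩ T ⊂ S :=
    ⟨Finset.inter_subset_left, fun h' => h (h'.trans Finset.inter_subset_right)⟩
  obtain ⟨u, hu, i, hi⟩ := hS (S ∩ T) hss ⟨v, by simp [hvS, hvT]⟩
  simp only [Finset.mem_sdiff, Finset.mem_inter, not_and] at hu hi
  exact ⟨_, hi.1, mem_outerBoundary.2 ⟨⟨u, hu.2, i, rfl⟩, hi.2 hi.1⟩⟩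

/-- The values allowed at `x` for an indicator function whose cluster is `S`. -/
def clusterValues {n : ℕ} (S : Finset (Vtx n)) (x : Vtx n) : Finset Bool :=
  if x ∈ S then {true} else if x ∈ outerBoundary S then {false} else Finset.univ

/-- Weight of site percolation with density `p` in which `v` is always open. -/
def siteWeight {n : ℕ} (p : ℝ) (v x : Vtx n) (b : Bool) : ℝ :=
  if x = v then (if b then 1 else 0) else (if b then p else 1 - p)

lemma disjoint_piFinset_clusterValues {n : ℕ} {S T : Finset (Vtx n)} {v : Vtx n}
    (hS : CubeConnected S) (hT : CubeConnected T) (hvS : v ∈ S) (hvT : v ∈ T) (h : S ≠ T) :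
    Disjoint (Fintype.piFinset (clusterValues S)) (Fintype.piFinset (clusterValues T)) := by
  rw [Finset.disjoint_left]
  intro f hf hg
  rw [Fintype.mem_piFinset] at hf hg
  have aux {A B : Finset (Vtx n)} (hA : CubeConnected A) (hvA : v ∈ A) (hvB : v ∈ B)
      (hAB : ¬ A ⊆ B) (h1 : ∀ x, f x ∈ clusterValues A x) (h2 : ∀ x, f x ∈ clusterValues B x) :
      False := by
    obtain ⟨w, hwA, hwB⟩ := hA.exists_mem_outerBoundary hvA hvB hAB
    have a := h1 w
    have b := h2 w
    simp [clusterValues, hwA, hwB, (mem_outerBoundary.1 hwB).2] at a b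
    simp [a] at b
  by_cases hST : S ⊆ T
  · exact aux hT hvT hvS (fun h' => h (hST.antisymm h')) hg hf
  · exact aux hS hvS hvT hST hf hg

lemma pow_mul_pow_le_sum_piFinset {n : ℕ} {p : ℝ} (hp0 : 0 ≤ p) (hp1 : p ≤ 1)
    {S : Finset (Vtx n)} {v : Vtx n} (hv : v ∈ S) :
    p ^ (S.card - 1) * (1 - p) ^ (S.card * n)
      ≤ ∑ f ∈ Fintype.piFinset (clusterValues S), ∏ x, siteWeight p v x (f x) := by
  rw [← Finset.prod_univ_sum]
  have hval (x : Vtx n) : ∑ b ∈ clusterValues S x, siteWeight p v x b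
      = (if x ∈ S.erase v then p else 1) * (if x ∈ outerBoundary S then 1 - p else 1) := by
    have hb : x ∈ outerBoundary S → x ∉ S := fun h => (mem_outerBoundary.1 h).2
    by_cases hxv : x = v
    · subst hxv
      have : x ∉ outerBoundary S := fun h => hb h hv
      simp [clusterValues, siteWeight, hv, this]
    · by_cases hxS : x ∈ S
      · have : x ∉ outerBoundary S := fun h => hb h hxS
        simp [clusterValues, siteWeight, hxS, hxv, this]
      · by_cases hx : x ∈ outerBoundary S <;> simp [clusterValues, siteWeight, hxS, hxv, hx]
  simp_rw [hval]
  rw [Finset.prod_mul_distrib, Finset.prod_ite_mem, Finset.prod_ite_mem]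
  simp only [Finset.univ_inter, Finset.prod_const, Finset.card_erase_of_mem hv]
  gcongr ?_ * ?_
  exact pow_le_pow_of_le_one (by linarith) (by linarith) (card_outerBoundary_le S)

/-- Connected vertex sets through `v` are few, by comparison with site percolation. -/
lemma sum_pow_mul_pow_le_one {n : ℕ} {p : ℝ} (hp0 : 0 ≤ p) (hp1 : p ≤ 1) (v : Vtx n)
    (F : Finset (Finset (Vtx n))) (hv : ∀ S ∈ F, v ∈ S) (hF : ∀ S ∈ F, CubeConnected S) :
    ∑ S ∈ F, p ^ (S.card - 1) * (1 - p) ^ (S.card * n) ≤ 1 := by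
  have hw (x : Vtx n) (b : Bool) : 0 ≤ siteWeight p v x b := by
    unfold siteWeight
    split_ifs <;> linarith
  calc ∑ S ∈ F, p ^ (S.card - 1) * (1 - p) ^ (S.card * n)
      ≤ ∑ S ∈ F, ∑ f ∈ Fintype.piFinset (clusterValues S), ∏ x, siteWeight p v x (f x) :=
        Finset.sum_le_sum fun S hS => pow_mul_pow_le_sum_piFinset hp0 hp1 (hv S hS)
    _ = ∑ f ∈ F.biUnion fun S => Fintype.piFinset (clusterValues S),
          ∏ x, siteWeight p v x (f x) := by
        rw [Finset.sum_biUnion]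
        intro S hS T hT h
        exact disjoint_piFinset_clusterValues (hF S hS) (hF T hT) (hv S hS) (hv T hT) h
    _ ≤ ∑ f : Vtx n → Bool, ∏ x, siteWeight p v x (f x) :=
        Finset.sum_le_sum_of_subset_of_nonneg (Finset.subset_univ _)
          fun f _ _ => Finset.prod_nonneg fun x _ => hw x _
    _ = 1 := by
        rw [← Fintype.piFinset_univ, ← Finset.prod_univ_sum]
        refine Finset.prod_eq_one fun x _ => ?_
        by_cases h : x = v <;> simp [siteWeight, h]

lemma sum_inv_pow_le_one {n : ℕ} (hn : 1 ≤ n) (v : Vtx n)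
    (F : Finset (Finset (Vtx n))) (hv : ∀ S ∈ F, v ∈ S) (hF : ∀ S ∈ F, CubeConnected S) :
    ∑ S ∈ F, (n : ℝ) / (4 * n : ℝ) ^ S.card ≤ 1 := by
  have hn' : (1 : ℝ) ≤ n := by exact_mod_cast hn
  have hp1 : 1 / (2 * n : ℝ) ≤ 1 := by
    rw [div_le_one (by positivity)]; linarith
  refine le_trans (Finset.sum_le_sum fun S hS => ?_)
    (sum_pow_mul_pow_le_one (p := 1 / (2 * n : ℝ)) (by positivity) hp1 v F hv hF)
  have hhalf : (1 / 2 : ℝ) ≤ (1 - 1 / (2 * n : ℝ)) ^ n := by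
    have := one_add_mul_le_pow (a := -(1 / (2 * n : ℝ))) (by linarith) n
    rw [← sub_eq_add_neg] at this
    refine le_trans (le_of_eq ?_) this
    field_simp
    ring
  obtain ⟨k, hk⟩ : ∃ k, S.card = k + 1 :=
    Nat.exists_eq_succ_of_ne_zero (Finset.card_pos.2 ⟨v, hv S hS⟩).ne'
  rw [hk, mul_comm (k + 1) n, pow_mul (1 - _)]
  calc (n : ℝ) / (4 * n : ℝ) ^ (k + 1) ≤ (1 / (2 * n : ℝ)) ^ k * (1 / 2) ^ (k + 1) := by
        have : (n : ℝ) / (4 * n : ℝ) ^ (k + 1)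
            = 1 / 2 * ((1 / (2 * n : ℝ)) ^ k * (1 / 2) ^ (k + 1)) := by
          rw [show (4 * n : ℝ) = (2 * n) * 2 by ring, mul_pow, one_div_pow, one_div_pow,
            pow_succ (2 * n : ℝ)]
          field_simp
        rw [this]
        exact mul_le_of_le_one_left (by positivity) (by norm_num)
    _ ≤ _ := by
        rw [Nat.add_sub_cancel]
        gcongr

/-- Every choice made by a vertex of `S` lies in `S`. -/
def IsClosedUnder {n : ℕ} (ω : Space15 n) (S : Finset (Vtx n)) : Prop :=
  ∀ v ∈ S, (ω.1.1 v : Vtx n) ∈ S ∧ (evenVtx v → (ω.1.2 v : Vtx n) ∈ S)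

lemma card_space15_subtype {n : ℕ}
    (Q : ∀ v : Vtx n, {u // (cubeGraph n).Adj v u} → {u // (cubeGraph n).Adj v u} → Prop) :
    Nat.card {ω : Space15 n // ∀ v, Q v (ω.1.1 v) (ω.1.2 v)}
      = ∏ v, Nat.card {q : {u // (cubeGraph n).Adj v u} × {u // (cubeGraph n).Adj v u} //
          (evenVtx v → (q.2 : Vtx n) ≠ q.1) ∧ Q v q.1 q.2} := by
  rw [← Nat.card_pi]
  exact Nat.card_congr
    { toFun := fun ω v => ⟨(ω.1.1.1 v, ω.1.1.2 v), ω.1.2 v, ω.2 v⟩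
      invFun := fun f => ⟨⟨(fun v => (f v).1.1, fun v => (f v).1.2), fun v => (f v).2.1⟩,
        fun v => (f v).2.2⟩
      left_inv := fun _ => rfl
      right_inv := fun _ => rfl }

lemma card_choices_mem {n : ℕ} (S : Finset (Vtx n)) (v : Vtx n) :
    Nat.card {q : {u // (cubeGraph n).Adj v u} × {u // (cubeGraph n).Adj v u} //
        (evenVtx v → (q.2 : Vtx n) ≠ q.1) ∧
          ((q.1 : Vtx n) ∈ S ∧ (evenVtx v → (q.2 : Vtx n) ∈ S))}
      = if evenVtx v then degIn S v * degIn S v - degIn S v else degIn S v * n := by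
  rw [Nat.card_eq_fintype_card, Fintype.card_subtype]
  split_ifs with h
  · rw [← card_filter_neighbor S v, ← Finset.offDiag_card]
    congr 1
    ext q
    simp only [h, forall_const, Finset.mem_filter, Finset.mem_univ, true_and, Finset.mem_offDiag,
      ne_eq, Subtype.ext_iff]
    tauto
  · have huniv := card_filter_neighbor Finset.univ v
    rw [degIn_univ] at huniv
    refine Eq.trans ?_ (congrArg₂ (· * ·) (card_filter_neighbor S v) huniv)
    rw [← Finset.card_product]
    congr 1
    ext q
    simp [h]

/-- The number of random choices made by `v`. -/
def numChoices {n : ℕ} (v : Vtx n) : ℕ := if evenVtx v then 2 else 1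

lemma sum_numChoices {n : ℕ} (S : Finset (Vtx n)) :
    ∑ v ∈ S, numChoices v = S.card + (S.filter evenVtx).card := by
  rw [Finset.card_filter, Finset.card_eq_sum_ones, ← Finset.sum_add_distrib]
  refine Finset.sum_congr rfl fun v _ => ?_
  unfold numChoices
  split_ifs <;> rfl

lemma card_choices_mem_mul_le {n : ℕ} (S : Finset (Vtx n)) (v : Vtx n) :
    (if evenVtx v then degIn S v * degIn S v - degIn S v else degIn S v * n) * n ^ numChoices v
      ≤ (if evenVtx v then n * n - n else n * n) * degIn S v ^ numChoices v := by
  have hd := degIn_le S v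
  unfold numChoices
  split_ifs with h
  · generalize degIn S v = d at *
    rw [← Nat.mul_sub_one, ← Nat.mul_sub_one]
    have : (d - 1) * n ≤ (n - 1) * d := by
      rw [Nat.sub_mul, Nat.sub_mul, mul_comm d n]
      omega
    calc d * (d - 1) * n ^ 2 = (d * n) * ((d - 1) * n) := by ring
      _ ≤ (d * n) * ((n - 1) * d) := Nat.mul_le_mul_left _ this
      _ = _ := by ring
  · apply le_of_eq
    ring

lemma card_space15 (n : ℕ) :
    Nat.card (Space15 n) = ∏ v : Vtx n, if evenVtx v then n * n - n else n * n := by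
  have := card_space15_subtype (n := n) fun v x y =>
    (x : Vtx n) ∈ Finset.univ ∧ (evenVtx v → (y : Vtx n) ∈ Finset.univ)
  simp_rw [card_choices_mem, degIn_univ] at this
  rw [← this]
  exact Nat.card_congr (Equiv.subtypeUnivEquiv (by simp)).symm

lemma card_isClosedUnder_mul_le {n : ℕ} (S : Finset (Vtx n)) :
    Nat.card {ω : Space15 n // IsClosedUnder ω S} * n ^ (S.card + (S.filter evenVtx).card)
      ≤ Nat.card (Space15 n) * ∏ v ∈ S, degIn S v ^ numChoices v := by
  have hcount := card_space15_subtype (n := n) fun v x y => v ∈ S →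
    (x : Vtx n) ∈ S ∧ (evenVtx v → (y : Vtx n) ∈ S)
  change Nat.card {ω : Space15 n // IsClosedUnder ω S} = _ at hcount
  have hfactor (v : Vtx n) :
      Nat.card {q : {u // (cubeGraph n).Adj v u} × {u // (cubeGraph n).Adj v u} //
        (evenVtx v → (q.2 : Vtx n) ≠ q.1) ∧
          (v ∈ S → (q.1 : Vtx n) ∈ S ∧ (evenVtx v → (q.2 : Vtx n) ∈ S))}
        * (if v ∈ S then n ^ numChoices v else 1)
      ≤ (if evenVtx v then n * n - n else n * n)
        * (if v ∈ S then degIn S v ^ numChoices v else 1) := by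
    by_cases hv : v ∈ S
    · simp only [hv, forall_const, if_true, card_choices_mem]
      exact card_choices_mem_mul_le S v
    · have := card_choices_mem Finset.univ v
      rw [degIn_univ] at this
      simp only [hv, if_false, mul_one, false_imp_iff]
      rw [← this]
      simp
  rw [hcount, card_space15, ← sum_numChoices, ← Finset.prod_pow_eq_pow_sum]
  calc _ = ∏ v, Nat.card {q : {u // (cubeGraph n).Adj v u} × {u // (cubeGraph n).Adj v u} //
        (evenVtx v → (q.2 : Vtx n) ≠ q.1) ∧
          (v ∈ S → (q.1 : Vtx n) ∈ S ∧ (evenVtx v → (q.2 : Vtx n) ∈ S))}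
        * (if v ∈ S then n ^ numChoices v else 1) := by
        rw [Finset.prod_mul_distrib, Finset.prod_ite_mem, Finset.univ_inter]
    _ ≤ ∏ v, (if evenVtx v then n * n - n else n * n)
        * (if v ∈ S then degIn S v ^ numChoices v else 1) :=
        Finset.prod_le_prod' fun v _ => hfactor v
    _ = _ := by rw [Finset.prod_mul_distrib, Finset.prod_ite_mem, Finset.univ_inter]

lemma prod_degIn_pow_le {n : ℕ} {S : Finset (Vtx n)} {L : ℝ} (hL : 0 < L)
    (hS : Real.logb 2 S.card ≤ L) :
    (∏ v ∈ S, (degIn S v : ℝ) ^ numChoices v) ≤ L ^ (2 * S.card) := by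
  calc (∏ v ∈ S, (degIn S v : ℝ) ^ numChoices v) ≤ ∏ v ∈ S, (degIn S v : ℝ) ^ 2 := by
        refine Finset.prod_le_prod (fun _ _ => by positivity) fun v _ => ?_
        unfold numChoices
        split_ifs
        · exact le_rfl
        · rw [pow_one]
          exact_mod_cast Nat.le_self_pow two_ne_zero (degIn S v)
    _ = (∏ v ∈ S, (degIn S v : ℝ)) ^ 2 := Finset.prod_pow _ _ _
    _ ≤ (L ^ S.card) ^ 2 := by
        refine pow_le_pow_left₀ (Finset.prod_nonneg fun _ _ => by positivity) ?_ 2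
        refine prod_le_pow_card_of_sum_le _ _ hL (fun _ _ => by positivity) ?_
        exact (sum_degIn_le S).trans (by gcongr)
    _ = L ^ (2 * S.card) := by rw [← pow_mul, mul_comm]

lemma card_isClosedUnder_le {n : ℕ} (hn : 1 ≤ n) {S : Finset (Vtx n)} {L : ℝ} (hL : 1 ≤ L)
    (hLn : 64 * L ^ 6 ≤ n) (hS : Real.logb 2 S.card ≤ L) (hne : S.Nonempty)
    (hcard : S.card ≤ 3 * (S.filter evenVtx).card) :
    (Nat.card {ω : Space15 n // IsClosedUnder ω S} : ℝ)
      ≤ Nat.card (Space15 n) * (64 * L ^ 6 / n ^ 2) * (n / (4 * n : ℝ) ^ S.card) := by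
  have hn' : (0 : ℝ) < n := by exact_mod_cast hn
  have h1 : (Nat.card {ω : Space15 n // IsClosedUnder ω S} : ℝ)
      * n ^ (S.card + (S.filter evenVtx).card) ≤ Nat.card (Space15 n) * L ^ (2 * S.card) := by
    have := card_isClosedUnder_mul_le S
    rify at this
    refine this.trans ?_
    gcongr
    exact prod_degIn_pow_le (by linarith) hS
  obtain ⟨b, hb⟩ : ∃ b, (S.filter evenVtx).card = b + 1 :=
    Nat.exists_eq_succ_of_ne_zero (by have := hne.card_pos; omega)
  rw [hb] at h1 hcard
  generalize S.card = k at *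
  have h2 : (4 * L ^ 2) ^ k ≤ 64 * L ^ 6 * (n : ℝ) ^ b := by
    calc (4 * L ^ 2) ^ k ≤ (4 * L ^ 2) ^ (3 * (b + 1)) := by
          apply pow_le_pow_right₀ _ hcard
          nlinarith
      _ = 64 * L ^ 6 * (64 * L ^ 6) ^ b := by rw [pow_mul, pow_succ]; ring
      _ ≤ _ := by gcongr
  rw [← le_div_iff₀ (by positivity)] at h1
  refine h1.trans ?_
  rw [mul_assoc, mul_div_assoc]
  gcongr
  rw [div_le_iff₀ (by positivity)]
  calc L ^ (2 * k) = (4 * L ^ 2) ^ k / 4 ^ k := by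
        rw [mul_pow, pow_mul]; field_simp
    _ ≤ 64 * L ^ 6 * (n : ℝ) ^ b / 4 ^ k := by gcongr
    _ = _ := by
        rw [mul_pow, pow_add, pow_succ (n : ℝ) b]
        field_simp

/-- The shapes that a minimal closed set with at most `K` vertices can have. -/
def smallShapes (n K : ℕ) : Finset (Finset (Vtx n)) :=
  Finset.univ.filter fun S => S.Nonempty ∧ S.card ≤ K ∧ CubeConnected S ∧
    S.card ≤ 3 * (S.filter evenVtx).card

lemma sum_card_isClosedUnder_le {n K : ℕ} (hn : 1 ≤ n) {L : ℝ} (hL : 1 ≤ L)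
    (hLn : 64 * L ^ 6 ≤ n) (hK : Real.logb 2 K ≤ L) :
    ∑ S ∈ smallShapes n K, (Nat.card {ω : Space15 n // IsClosedUnder ω S} : ℝ)
      ≤ 2 ^ n * (Nat.card (Space15 n) * (64 * L ^ 6 / n ^ 2)) := by
  have hmem {S : Finset (Vtx n)} (hS : S ∈ smallShapes n K) := (Finset.mem_filter.1 hS).2
  calc ∑ S ∈ smallShapes n K, (Nat.card {ω : Space15 n // IsClosedUnder ω S} : ℝ)
      ≤ ∑ S ∈ smallShapes n K, ∑ v ∈ S,
          (Nat.card {ω : Space15 n // IsClosedUnder ω S} : ℝ) := by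
        refine Finset.sum_le_sum fun S hS => ?_
        rw [Finset.sum_const, nsmul_eq_mul]
        refine le_mul_of_one_le_left (by positivity) ?_
        exact_mod_cast (hmem hS).1.card_pos
    _ = ∑ v, ∑ S ∈ (smallShapes n K).filter (fun S => v ∈ S),
          (Nat.card {ω : Space15 n // IsClosedUnder ω S} : ℝ) :=
        Finset.sum_comm' (by simp [and_comm])
    _ ≤ ∑ v : Vtx n, Nat.card (Space15 n) * (64 * L ^ 6 / n ^ 2) := by
        refine Finset.sum_le_sum fun v _ => ?_
        calc _ ≤ ∑ S ∈ (smallShapes n K).filter (fun S => v ∈ S),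
              Nat.card (Space15 n) * (64 * L ^ 6 / n ^ 2) * (n / (4 * n : ℝ) ^ S.card) := by
              refine Finset.sum_le_sum fun S hS => ?_
              obtain ⟨hne, hc, -, h3⟩ := hmem (Finset.mem_filter.1 hS).1
              refine card_isClosedUnder_le hn hL hLn (le_trans ?_ hK) hne h3
              have : (0 : ℝ) < S.card := by exact_mod_cast hne.card_pos
              exact Real.logb_le_logb_of_le (by norm_num) this (by exact_mod_cast hc)
          _ ≤ _ := by
              rw [← Finset.mul_sum]
              refine mul_le_of_le_one_right (by positivity) ?_
              refine sum_inv_pow_le_one hn v _ (fun S hS => (Finset.mem_filter.1 hS).2)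
                fun S hS => (hmem (Finset.mem_filter.1 hS).1).2.2.1
    _ = _ := by simp

/-- `S` is a nonempty closed set none of whose proper subsets is nonempty and closed. -/
def IsMinimalClosed {n : ℕ} (ω : Space15 n) (S : Finset (Vtx n)) : Prop :=
  S.Nonempty ∧ IsClosedUnder ω S ∧ ∀ T ⊂ S, T.Nonempty → ¬ IsClosedUnder ω T

lemma IsMinimalClosed.cubeConnected {n : ℕ} {ω : Space15 n} {S : Finset (Vtx n)}
    (h : IsMinimalClosed ω S) : CubeConnected S := by
  intro T hT hne
  have := h.2.2 T hT hne
  simp only [IsClosedUnder, not_forall] at this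
  obtain ⟨v, hv, hT'⟩ := this
  refine ⟨v, hv, ?_⟩
  have hS := h.2.1 v (hT.1 hv)
  obtain ⟨i, hi⟩ := cubeGraph_adj_iff.1 (ω.1.1 v).2
  obtain ⟨j, hj⟩ := cubeGraph_adj_iff.1 (ω.1.2 v).2
  by_cases h1 : (ω.1.1 v : Vtx n) ∈ T
  · have h2 : evenVtx v ∧ (ω.1.2 v : Vtx n) ∉ T := by tauto
    exact ⟨j, by rw [hj]; exact Finset.mem_sdiff.2 ⟨hS.2 h2.1, h2.2⟩⟩
  · exact ⟨i, by rw [hi]; exact Finset.mem_sdiff.2 ⟨hS.1, h1⟩⟩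

lemma IsMinimalClosed.card_le {n : ℕ} {ω : Space15 n} {S : Finset (Vtx n)}
    (h : IsMinimalClosed ω S) : S.card ≤ 3 * (S.filter evenVtx).card := by
  obtain ⟨⟨v, hv⟩, hcl, hmin⟩ := h
  set A := S.filter evenVtx with hA
  set T := A ∪ (A.image (fun v => (ω.1.1 v : Vtx n)) ∪ A.image (fun v => (ω.1.2 v : Vtx n)))
    with hT
  have hTS : T ⊆ S := by
    intro w hw
    simp only [hT, Finset.mem_union, Finset.mem_image, hA, Finset.mem_filter] at hw
    rcases hw with hw | ⟨u, hu, rfl⟩ | ⟨u, hu, rfl⟩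
    · exact hw.1
    · exact (hcl u hu.1).1
    · exact (hcl u hu.1).2 hu.2
  have hTne : T.Nonempty := by
    by_cases he : evenVtx v
    · exact ⟨v, by simp [hT, hA, hv, he]⟩
    · refine ⟨ω.1.1 v, Finset.mem_union_left _ (Finset.mem_filter.2 ⟨(hcl v hv).1, ?_⟩)⟩
      exact evenVtx_of_adj (ω.1.1 v).2 he
  have hTcl : IsClosedUnder ω T := by
    intro w hw
    by_cases he : evenVtx w
    · have : w ∈ A := Finset.mem_filter.2 ⟨hTS hw, he⟩
      exact ⟨Finset.mem_union_right _ (Finset.mem_union_left _ (Finset.mem_image_of_mem _ this)),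
        fun _ => Finset.mem_union_right _
          (Finset.mem_union_right _ (Finset.mem_image_of_mem (fun v => (ω.1.2 v : Vtx n)) this))⟩
    · exact ⟨Finset.mem_union_left _ (Finset.mem_filter.2
        ⟨(hcl w (hTS hw)).1, evenVtx_of_adj (ω.1.1 w).2 he⟩), fun h => absurd h he⟩
  have hEq : T = S := by
    by_contra hne
    exact hmin T (hTS.ssubset_of_ne hne) hTne hTcl
  have h1 : S.card ≤ A.card + (A.card + A.card) := by
    rw [← hEq, hT]
    refine (Finset.card_union_le _ _).trans (Nat.add_le_add_left ?_ _)
    exact (Finset.card_union_le _ _).trans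
      (Nat.add_le_add Finset.card_image_le Finset.card_image_le)
  omega

lemma isClosedUnder_supp {n : ℕ} (ω : Space15 n) (C : (graph15 n ω).ConnectedComponent) :
    IsClosedUnder ω C.supp.toFinset := by
  intro v hv
  rw [Set.mem_toFinset, SimpleGraph.ConnectedComponent.mem_supp_iff] at hv
  have step {u : Vtx n} (h : (graph15 n ω).Adj v u) : u ∈ C.supp.toFinset := by
    rw [Set.mem_toFinset, SimpleGraph.ConnectedComponent.mem_supp_iff, ← hv]
    exact SimpleGraph.ConnectedComponent.eq.2 h.symm.reachable
  refine ⟨step ?_, fun he => step ?_⟩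
  · exact (SimpleGraph.fromRel_adj _ _ _).2 ⟨(ω.1.1 v).2.ne, Or.inl (Or.inl rfl)⟩
  · exact (SimpleGraph.fromRel_adj _ _ _).2 ⟨(ω.1.2 v).2.ne, Or.inl (Or.inr ⟨he, rfl⟩)⟩

lemma exists_isMinimalClosed {n : ℕ} {ω : Space15 n} {S : Finset (Vtx n)} (hS : S.Nonempty)
    (hcl : IsClosedUnder ω S) : ∃ T ⊆ S, IsMinimalClosed ω T := by
  obtain ⟨T, hT, hmin⟩ := Finset.exists_min_image
    (S.powerset.filter fun T => T.Nonempty ∧ IsClosedUnder ω T) Finset.card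
    ⟨S, by simp [hS, hcl]⟩
  simp only [Finset.mem_filter, Finset.mem_powerset] at hT hmin
  refine ⟨T, hT.1, hT.2.1, hT.2.2, fun U hU hne hUcl => ?_⟩
  exact (Finset.card_lt_card hU).not_ge (hmin U ⟨hU.1.trans hT.1, hne, hUcl⟩)

lemma card_connectedComponent_le {n : ℕ} (ω : Space15 n) (K : ℕ) (hK : 0 < K) :
    (Nat.card (graph15 n ω).ConnectedComponent : ℝ)
      ≤ 2 ^ n / K + ((smallShapes n K).filter (IsClosedUnder ω)).card := by
  have hne (C : (graph15 n ω).ConnectedComponent) : C.supp.toFinset.Nonempty :=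
    Set.toFinset_nonempty.2 C.nonempty_supp
  choose m hsub hm using fun C => exists_isMinimalClosed (hne C) (isClosedUnder_supp ω C)
  have hdisj {C D : (graph15 n ω).ConnectedComponent} (h : C ≠ D) : Disjoint (m C) (m D) := by
    rw [Finset.disjoint_left]
    intro v hv hv'
    have h1 := hsub C hv
    have h2 := hsub D hv'
    rw [Set.mem_toFinset, SimpleGraph.ConnectedComponent.mem_supp_iff] at h1 h2
    exact h (h1.symm.trans h2)
  rw [Nat.card_eq_fintype_card, ← Finset.card_univ,
    ← Finset.card_filter_add_card_filter_not (fun C => K < (m C).card), Nat.cast_add]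
  refine add_le_add ?_ ?_
  · rw [le_div_iff₀ (by exact_mod_cast hK)]
    have : (Finset.univ.filter fun C => K < (m C).card).card * K ≤ 2 ^ n := by
      calc _ = ∑ C ∈ Finset.univ.filter fun C => K < (m C).card, K := by simp
        _ ≤ ∑ C ∈ Finset.univ.filter fun C => K < (m C).card, (m C).card :=
            Finset.sum_le_sum fun C hC => (Finset.mem_filter.1 hC).2.le
        _ = ((Finset.univ.filter fun C => K < (m C).card).biUnion m).card :=
            (Finset.card_biUnion fun C _ D _ h => hdisj h).symm
        _ ≤ Fintype.card (Vtx n) := Finset.card_le_univ _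
        _ = 2 ^ n := by simp
    exact_mod_cast this
  · norm_cast
    refine Finset.card_le_card_of_injOn m ?_ ?_
    · intro C hC
      have hC' : (m C).card ≤ K := not_lt.1 (Finset.mem_filter.1 hC).2
      simp only [Finset.coe_filter, Set.mem_ofPred_eq, smallShapes, Finset.mem_filter,
        Finset.mem_univ, true_and]
      exact ⟨⟨(hm C).1, hC', (hm C).cubeConnected, (hm C).card_le⟩, (hm C).2.1⟩
    · intro C _ D _ h
      by_contra hCD
      have := hdisj hCD
      rw [h, disjoint_self] at this
      exact (hm D).1.ne_empty this

lemma sum_card_connectedComponent_le {n K : ℕ} (hn : 1 ≤ n) (hKpos : 0 < K) {L : ℝ} (hL : 1 ≤ L)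
    (hLn : 64 * L ^ 6 ≤ n) (hK : Real.logb 2 K ≤ L) :
    ∑ ω : Space15 n, (Nat.card (graph15 n ω).ConnectedComponent : ℝ)
      ≤ Nat.card (Space15 n) * (2 ^ n * (1 / K + 64 * L ^ 6 / n ^ 2)) := by
  calc _ ≤ ∑ ω : Space15 n,
        (2 ^ n / (K : ℝ) + ((smallShapes n K).filter (IsClosedUnder ω)).card) :=
        Finset.sum_le_sum fun ω _ => card_connectedComponent_le ω K hKpos
    _ = Nat.card (Space15 n) * (2 ^ n / (K : ℝ)) + ∑ S ∈ smallShapes n K,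
          (Nat.card {ω : Space15 n // IsClosedUnder ω S} : ℝ) := by
        rw [Finset.sum_add_distrib, Finset.sum_const, nsmul_eq_mul, Finset.card_univ,
          Nat.card_eq_fintype_card]
        congr 1
        simp_rw [Nat.card_eq_fintype_card, Fintype.card_subtype, Finset.card_filter,
          Nat.cast_sum]
        exact Finset.sum_comm
    _ ≤ Nat.card (Space15 n) * (2 ^ n / (K : ℝ))
          + 2 ^ n * (Nat.card (Space15 n) * (64 * L ^ 6 / n ^ 2)) := by
        gcongr
        exact sum_card_isClosedUnder_le hn hL hLn hK
    _ = _ := by ring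

/-- Markov's inequality for `prob`. -/
lemma one_sub_le_prob_of_sum_le {Ω : Type*} [Fintype Ω] [Nonempty Ω] {X : Ω → ℝ}
    (hX : ∀ ω, 0 ≤ X ω) {t E : ℝ} (ht : 0 < t) (h : ∑ ω, X ω ≤ Nat.card Ω * E) :
    1 - E / t ≤ prob fun ω => X ω ≤ t := by
  have hpos : (0 : ℝ) < Nat.card Ω := by exact_mod_cast Nat.card_pos
  rw [prob, le_div_iff₀ hpos]
  have hcompl : (Nat.card {ω // X ω ≤ t} : ℝ) + (Finset.univ.filter fun ω => ¬ X ω ≤ t).card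
      = Nat.card Ω := by
    rw [Nat.card_eq_fintype_card, Nat.card_eq_fintype_card, Fintype.card_subtype]
    exact_mod_cast Finset.card_filter_add_card_filter_not _
  have hmarkov : (Finset.univ.filter fun ω => ¬ X ω ≤ t).card * t ≤ Nat.card Ω * E := by
    calc _ = ∑ ω ∈ Finset.univ.filter fun ω => ¬ X ω ≤ t, t := by simp
      _ ≤ ∑ ω ∈ Finset.univ.filter fun ω => ¬ X ω ≤ t, X ω :=
          Finset.sum_le_sum fun ω hω => (not_le.1 (Finset.mem_filter.1 hω).2).le
      _ ≤ ∑ ω, X ω := Finset.sum_le_sum_of_subset_of_nonneg (Finset.subset_univ _)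
          fun ω _ _ => hX ω
      _ ≤ _ := h
  rw [← le_div_iff₀ ht] at hmarkov
  have : (1 - E / t) * (Nat.card Ω : ℝ) = Nat.card Ω - Nat.card Ω * E / t := by ring
  linarith

lemma prob_le_one {Ω : Type*} [Finite Ω] (p : Ω → Prop) : prob p ≤ 1 :=
  div_le_one_of_le₀ (by exact_mod_cast Finite.card_subtype_le p) (by positivity)

lemma nonempty_space15 {n : ℕ} (hn : 2 ≤ n) : Nonempty (Space15 n) := by
  refine (Nat.card_pos_iff.1 ?_).1
  rw [card_space15]
  refine Finset.prod_pos fun v _ => ?_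
  have : n < n * n := by nlinarith
  split_ifs <;> omega


lemma tendsto_logb_pow_div_atTop (k : ℕ) :
    Tendsto (fun n : ℕ => Real.logb 2 n ^ k / n) atTop (nhds 0) := by
  have h := ((Real.isLittleO_pow_log_id_atTop (n := k)).tendsto_div_nhds_zero.comp
    (tendsto_natCast_atTop_atTop (R := ℝ))).const_mul ((Real.log 2 ^ k)⁻¹)
  rw [mul_zero] at h
  refine h.congr fun n => ?_
  simp only [Function.comp, id, Real.logb, div_pow]
  ring

/-- W.h.p. `Q^n(1.5)` consists of at most `5·2^n / (n·log₂log₂ n)` connected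
components. -/
theorem stmt_13 :
    Tendsto (fun n : ℕ =>
        prob (fun ω : Space15 n =>
          (Nat.card (graph15 n ω).ConnectedComponent : ℝ)
            ≤ 5 * 2 ^ n / ((n : ℝ) * Real.logb 2 (Real.logb 2 n))))
      atTop (nhds 1) := by
  have hlim := tendsto_logb_pow_div_atTop 7
  have hlower : Tendsto (fun n : ℕ => 1 - 1000 * (Real.logb 2 n ^ 7 / n)) atTop (nhds 1) := by
    simpa using (hlim.const_mul 1000).const_sub 1
  refine tendsto_of_tendsto_of_tendsto_of_le_of_le' hlower tendsto_const_nhds ?_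
    (Eventually.of_forall fun n => prob_le_one _)
  filter_upwards [eventually_ge_atTop 4, hlim.eventually_le_const (u := 1 / 4096) (by norm_num)]
    with n hn hsmall
  have hn' : (4 : ℝ) ≤ n := by exact_mod_cast hn
  have hx : 2 ≤ Real.logb 2 n := by
    rw [Real.le_logb_iff_rpow_le (by norm_num) (by linarith)]
    norm_num
    exact hn
  set x := Real.logb 2 n with hxdef
  have hy0 : 0 < Real.logb 2 x := Real.logb_pos (by norm_num) (by linarith)
  have hyx : Real.logb 2 x ≤ x := by
    rw [Real.logb_le_iff_le_rpow (by norm_num) (by linarith)]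
    have := one_add_mul_self_le_rpow_one_add (s := 1) (by norm_num) (p := x) (by linarith)
    norm_num at this
    linarith
  set y := Real.logb 2 x
  have hx6 : 1 ≤ x ^ 6 := one_le_pow₀ (by linarith)
  have hLn : 64 * (2 * x) ^ 6 ≤ n := by
    rw [div_le_iff₀ (by linarith)] at hsmall
    nlinarith [pow_succ x 6]
  have hK : Real.logb 2 ((n ^ 2 : ℕ) : ℝ) ≤ 2 * x := by
    rw [Nat.cast_pow, Real.logb_pow, Nat.cast_ofNat]
  have := nonempty_space15 (n := n) (by omega)
  have hmarkov := one_sub_le_prob_of_sum_le (Ω := Space15 n) (fun ω => Nat.cast_nonneg _)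
    (t := 5 * 2 ^ n / (n * y)) (by positivity)
    (sum_card_connectedComponent_le (n := n) (K := n ^ 2) (by omega) (by positivity)
      (L := 2 * x) (by linarith) hLn hK)
  refine le_trans ?_ hmarkov
  refine sub_le_sub_left ?_ 1
  have : 2 ^ n * (1 / ((n ^ 2 : ℕ) : ℝ) + 64 * (2 * x) ^ 6 / n ^ 2) / (5 * 2 ^ n / (n * y))
      = (1 + 4096 * x ^ 6) * y / 5 / n := by
    push_cast
    field_simp
    ring
  rw [this, mul_div_assoc']
  gcongr
  have h1 : (1 + 4096 * x ^ 6) * y ≤ (5000 * x ^ 6) * x := by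
    gcongr
    linarith
  nlinarith [pow_succ x 6]
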